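/- Let R be a Cohen–Macaulay local ring of dimension d ≥ 2, and let 1 ≤ n ≤ d−1. Let M be a finitely generated R-module such that M_p has finite projective dimension over R_p for every prime p of height at most n. Let N be a maximal Cohen–Macaulay R-module with Supp N = Spec R. If Ext^i_R(M, N) = 0 for all 1 ≤ i ≤ d and Ext^j_R(Hom_R(M,R), Hom_R(M,N)) = 0 for all n ≤ j ≤ d−1, then M is free. -/

import Mathlib

open CategoryTheory TensorProduct IsLocalRing

noncomputable section

/-- The `n`-th Ext group of two `R`-modules. -/
abbrev extGroup (R : Type) [CommRing R] (n : ℕ) (M N : Type) [AddCommGroup M] [Module R M]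
    [AddCommGroup N] [Module R N] : Type :=
  ((Ext R (ModuleCat R) n).obj (Opposite.op (ModuleCat.of R M))).obj (ModuleCat.of R N)

/-- The `n`-th Tor group of two `R`-modules. -/
abbrev torGroup (R : Type) [CommRing R] (n : ℕ) (M N : Type) [AddCommGroup M] [Module R M]
    [AddCommGroup N] [Module R N] : Type :=
  ((Tor (ModuleCat R) n).obj (ModuleCat.of R M)).obj (ModuleCat.of R N)

/-- The depth of a module over a local ring, as the infimum of the degrees in which
`Ext(k, N)` is nonzero. -/
def moduleDepth (R : Type) [CommRing R] [IsLocalRing R] (N : Type) [AddCommGroup N]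
    [Module R N] : ℕ∞ :=
  sInf {n : ℕ∞ | ∃ k : ℕ, n = k ∧
    Nontrivial (extGroup R k (R ⧸ IsLocalRing.maximalIdeal R) N)}

/-- A module is maximal Cohen–Macaulay if `depth M_p = dim R_p` for all `p` in the support. -/
def IsMCM (R : Type) [CommRing R] (M : Type) [AddCommGroup M] [Module R M] : Prop :=
  ∀ p : PrimeSpectrum R, Nontrivial (LocalizedModule p.asIdeal.primeCompl M) →
    (moduleDepth (Localization.AtPrime p.asIdeal)
        (LocalizedModule p.asIdeal.primeCompl M) : WithBot ℕ∞) =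
      ringKrullDim (Localization.AtPrime p.asIdeal)

/-- A local ring is Cohen–Macaulay if its depth equals its Krull dimension. -/
def IsCMLocal (R : Type) [CommRing R] [IsLocalRing R] : Prop :=
  (moduleDepth R R : WithBot ℕ∞) = ringKrullDim R

/-- Injective dimension at most `n`, defined recursively via cosyzygies. -/
def hasInjDimLE (R : Type) [CommRing R] : ℕ → ∀ (M : Type) [AddCommGroup M] [Module R M], Prop
  | 0, M, _, _ => Module.Injective R M
  | (n+1), M, _, _ => ∃ (I : Type) (_ : AddCommGroup I) (_ : Module R I) (f : M →ₗ[R] I),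
      Module.Injective R I ∧ Function.Injective f ∧
        hasInjDimLE R n (I ⧸ LinearMap.range f)

/-- Projective dimension at most `n`, defined recursively via syzygies. -/
def hasPdLE (R : Type) [CommRing R] : ℕ → ∀ (M : Type) [AddCommGroup M] [Module R M], Prop
  | 0, M, _, _ => Module.Projective R M
  | (n+1), M, _, _ => ∃ (P : Type) (_ : AddCommGroup P) (_ : Module R P) (f : P →ₗ[R] M),
      Module.Projective R P ∧ Function.Surjective f ∧ hasPdLE R n (LinearMap.ker f)

/-- `ω` is a canonical module of the Cohen–Macaulay local ring `R`: it is finitely generated,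
maximal Cohen–Macaulay, of finite injective dimension, and of type one. -/
def IsCanonicalModule (R : Type) [CommRing R] [IsLocalRing R] (ω : Type) [AddCommGroup ω]
    [Module R ω] : Prop :=
  Module.Finite R ω ∧ IsMCM R ω ∧ (∃ n, hasInjDimLE R n ω) ∧
    ∃ d : ℕ, ringKrullDim R = d ∧
      Nonempty (extGroup R d (R ⧸ IsLocalRing.maximalIdeal R) ω ≃ₗ[R]
        (R ⧸ IsLocalRing.maximalIdeal R))

/-- `T` is an Auslander transpose of `M`: the cokernel of the `R`-dual of a minimal
free presentation of `M`. -/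
def IsAuslanderTranspose (R : Type) [CommRing R] [IsLocalRing R] (M T : Type)
    [AddCommGroup M] [Module R M] [AddCommGroup T] [Module R T] : Prop :=
  ∃ (m n : ℕ) (f : (Fin n → R) →ₗ[R] (Fin m → R)),
    LinearMap.range f ≤ (IsLocalRing.maximalIdeal R) • (⊤ : Submodule R (Fin m → R)) ∧
    LinearMap.ker f ≤ (IsLocalRing.maximalIdeal R) • (⊤ : Submodule R (Fin n → R)) ∧
    Nonempty (((Fin m → R) ⧸ LinearMap.range f) ≃ₗ[R] M) ∧
    Nonempty ((Module.Dual R (Fin n → R) ⧸ LinearMap.range f.dualMap) ≃ₗ[R] T)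

end

/-- Vanishing of an Ext group of modules. -/
def ExtVanish (R : Type) [CommRing R] (i : ℕ) (K C : Type) [AddCommGroup K] [Module R K]
    [AddCommGroup C] [Module R C] : Prop :=
  Subsingleton (Abelian.Ext (ModuleCat.of R K) (ModuleCat.of R C) i)

section
variable {R : Type} [CommRing R]

theorem CategoryTheory.ProjectiveResolution.subsingleton_ext_succ_iff {X Y : ModuleCat.{0} R}
    (P : ProjectiveResolution X) (n : ℕ) :
    Subsingleton (Abelian.Ext X Y (n + 1)) ↔ ∀ f : P.complex.X (n + 1) ⟶ Y,
      P.complex.d (n + 2) (n + 1) ≫ f = 0 → ∃ g, P.complex.d (n + 1) n ≫ g = f := by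
  constructor
  · intro h f hf
    exact (P.extMk_eq_zero_iff f (n + 2) rfl hf n rfl).1 (Subsingleton.elim _ _)
  · intro h
    refine subsingleton_of_forall_eq 0 fun x => ?_
    obtain ⟨f, hf, rfl⟩ := P.extMk_surjective x (n + 2) rfl
    exact (P.extMk_eq_zero_iff f (n + 2) rfl hf n rfl).2 (h f hf)

theorem CategoryTheory.ProjectiveResolution.subsingleton_ext_zero_iff {X Y : ModuleCat.{0} R}
    (P : ProjectiveResolution X) :
    Subsingleton (Abelian.Ext X Y 0) ↔ ∀ f : P.complex.X 0 ⟶ Y,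
      P.complex.d 1 0 ≫ f = 0 → f = 0 := by
  rw [Abelian.Ext.addEquiv₀.toEquiv.subsingleton_congr]
  constructor
  · intro h f hf
    obtain ⟨g, rfl⟩ : ∃ g, P.π.f 0 ≫ g = f :=
      ⟨P.exact₀.desc f hf, P.exact₀.g_desc f hf⟩
    have hg : g = 0 := @Subsingleton.elim (X ⟶ Y) h g 0
    rw [hg, Limits.comp_zero]
  · intro h
    refine subsingleton_of_forall_eq 0 fun g => ?_
    have := h (P.π.f 0 ≫ g) ((Category.assoc _ _ _).symm.trans
      ((congrArg (· ≫ g) P.complex_d_comp_π_f_zero).trans Limits.zero_comp))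
    exact (cancel_epi (P.π.f 0)).1 (this.trans Limits.comp_zero.symm)

theorem CategoryTheory.ProjectiveResolution.subsingleton_leftDerived_succ_iff
    {X Y : ModuleCat.{0} R}
    (P : ProjectiveResolution X) (n : ℕ) :
    Subsingleton (((Ext R (ModuleCat.{0} R) (n + 1)).obj (Opposite.op X)).obj Y) ↔
     ∀ f : P.complex.X (n + 1) ⟶ Y,
      P.complex.d (n + 2) (n + 1) ≫ f = 0 → ∃ g, P.complex.d (n + 1) n ≫ g = f := by
  rw [← ModuleCat.isZero_iff_subsingleton, (P.isoExt (R := R) (n + 1) Y).isZero_iff,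
    ← HomologicalComplex.exactAt_iff_isZero_homology,
    HomologicalComplex.exactAt_iff' _ n (n + 1) (n + 2) (by simp) (by simp),
    ShortComplex.moduleCat_exact_iff]
  rfl

theorem CategoryTheory.ProjectiveResolution.subsingleton_leftDerived_zero_iff
    {X Y : ModuleCat.{0} R}
    (P : ProjectiveResolution X) :
    Subsingleton (((Ext R (ModuleCat.{0} R) 0).obj (Opposite.op X)).obj Y) ↔
     ∀ f : P.complex.X 0 ⟶ Y,
      P.complex.d 1 0 ≫ f = 0 → f = 0 := by
  rw [← ModuleCat.isZero_iff_subsingleton, (P.isoExt (R := R) 0 Y).isZero_iff,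
    ← HomologicalComplex.exactAt_iff_isZero_homology,
    HomologicalComplex.exactAt_iff' _ 0 0 1 (by simp) (by simp),
    ShortComplex.moduleCat_exact_iff]
  constructor
  · intro h f hf
    obtain ⟨g, hg⟩ := h f hf
    rw [← hg]
    change P.complex.d 0 0 ≫ (show P.complex.X 0 ⟶ Y from g) = 0
    rw [P.complex.shape 0 0 (by simp), Limits.zero_comp]
  · intro h f hf
    exact ⟨0, by rw [map_zero]; exact (h f hf).symm⟩

theorem subsingleton_extGroup_iff {i : ℕ} {M N : Type} [AddCommGroup M] [Module R M]
    [AddCommGroup N] [Module R N] : Subsingleton (extGroup R i M N) ↔ ExtVanish R i M N := by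
  let P := projectiveResolution (ModuleCat.of R M)
  cases i with
  | zero =>
    exact P.subsingleton_leftDerived_zero_iff.trans P.subsingleton_ext_zero_iff.symm
  | succ i =>
    exact (P.subsingleton_leftDerived_succ_iff i).trans (P.subsingleton_ext_succ_iff i).symm

variable {A B C X Y : Type} [AddCommGroup A] [Module R A] [AddCommGroup B] [Module R B]
  [AddCommGroup C] [Module R C] [AddCommGroup X] [Module R X] [AddCommGroup Y] [Module R Y]

open Abelian

theorem ModuleCat.shortExact_of_exact {f : A →ₗ[R] B} {g : B →ₗ[R] C} (hf : Function.Injective f)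
    (hfg : Function.Exact f g) (hg : Function.Surjective g) :
    (ShortComplex.mk (ModuleCat.ofHom f) (ModuleCat.ofHom g)
      (by rw [← ModuleCat.ofHom_comp, hfg.linearMap_comp_eq_zero]; rfl)).ShortExact where
  exact := (ShortComplex.ShortExact.moduleCat_exact_iff_function_exact _).2 hfg
  mono_f := (ModuleCat.mono_iff_injective _).2 hf
  epi_g := (ModuleCat.epi_iff_surjective _).2 hg

namespace ExtVanish

theorem iff_forall {i : ℕ} : ExtVanish R i X Y ↔
    ∀ x : Abelian.Ext (ModuleCat.of R X) (ModuleCat.of R Y) i, x = 0 :=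
  ⟨fun h x => @Subsingleton.elim _ h x 0, fun h => subsingleton_of_forall_eq 0 h⟩

theorem zero_iff : ExtVanish R 0 X Y ↔ ∀ f : X →ₗ[R] Y, f = 0 := by
  unfold ExtVanish
  rw [(Ext.addEquiv₀.toEquiv.trans ModuleCat.homEquiv).subsingleton_congr]
  exact ⟨fun h f => @Subsingleton.elim _ h f 0, fun h => subsingleton_of_forall_eq 0 h⟩

theorem succ_of_projective [Module.Projective R X] (i : ℕ) : ExtVanish R (i + 1) X Y :=
  iff_forall.2 fun x => Ext.eq_zero_of_projective x

section
variable {f : A →ₗ[R] B} {g : B →ₗ[R] C} (hf : Function.Injective f)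
    (hfg : Function.Exact f g) (hg : Function.Surjective g) {i : ℕ}
include hf hfg hg

theorem covariant_left (h₃ : ExtVanish R i X C) (h₂ : ExtVanish R (i + 1) X B) :
    ExtVanish R (i + 1) X A := by
  rw [iff_forall] at *
  intro x
  obtain ⟨y, rfl⟩ := Ext.covariant_sequence_exact₁ _ (ModuleCat.shortExact_of_exact hf hfg hg) x
    (h₂ _) rfl
  rw [h₃ y, Ext.zero_comp]

theorem covariant_right (h₂ : ExtVanish R i X B) (h₁ : ExtVanish R (i + 1) X A) :
    ExtVanish R i X C := by
  rw [iff_forall] at *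
  intro x
  obtain ⟨y, rfl⟩ := Ext.covariant_sequence_exact₃ _ (ModuleCat.shortExact_of_exact hf hfg hg) x
    rfl (h₁ _)
  rw [h₂ y, Ext.zero_comp]

theorem contravariant_left (h₂ : ExtVanish R i B Y) (h₃ : ExtVanish R (i + 1) C Y) :
    ExtVanish R i A Y := by
  rw [iff_forall] at *
  intro x
  obtain ⟨y, rfl⟩ := Ext.contravariant_sequence_exact₁ (ModuleCat.shortExact_of_exact hf hfg hg)
    _ x (add_comm 1 i) (h₃ _)
  rw [h₂ y, Ext.comp_zero]

theorem contravariant_right (h₁ : ExtVanish R i A Y) (h₂ : ExtVanish R (i + 1) B Y) :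
    ExtVanish R (i + 1) C Y := by
  rw [iff_forall] at *
  intro x
  obtain ⟨y, rfl⟩ := Ext.contravariant_sequence_exact₃ (ModuleCat.shortExact_of_exact hf hfg hg)
    _ x (h₂ _) (add_comm 1 i)
  rw [h₁ y, Ext.comp_zero]

theorem shift_iff [Module.Projective R B] :
    ExtVanish R (i + 2) C Y ↔ ExtVanish R (i + 1) A Y :=
  ⟨fun h => contravariant_left hf hfg hg (succ_of_projective i) h,
    fun h => contravariant_right hf hfg hg h (succ_of_projective _)⟩

theorem exists_extension (h : ExtVanish R 1 C Y) (φ : A →ₗ[R] Y) :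
    ∃ ψ : B →ₗ[R] Y, ψ ∘ₗ f = φ := by
  rw [iff_forall] at h
  obtain ⟨y, hy⟩ := Ext.contravariant_sequence_exact₁ (ModuleCat.shortExact_of_exact hf hfg hg)
    (ModuleCat.of R Y) (Ext.mk₀ (ModuleCat.ofHom φ)) (add_comm 1 0) (h _)
  obtain ⟨ψ, rfl⟩ := Ext.addEquiv₀.symm.surjective y
  refine ⟨ψ.hom, ?_⟩
  simp only [Ext.addEquiv₀_symm_apply, Ext.mk₀_comp_mk₀] at hy
  have := Ext.addEquiv₀.symm.injective hy
  exact congrArg ModuleCat.Hom.hom this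

theorem one_of_exists_extension [Module.Projective R B]
    (h : ∀ φ : A →ₗ[R] Y, ∃ ψ : B →ₗ[R] Y, ψ ∘ₗ f = φ) : ExtVanish R 1 C Y := by
  rw [iff_forall]
  intro x
  obtain ⟨y, rfl⟩ := Ext.contravariant_sequence_exact₃ (ModuleCat.shortExact_of_exact hf hfg hg)
    _ x (Ext.eq_zero_of_projective _) (add_comm 1 0)
  obtain ⟨φ, rfl⟩ := Ext.addEquiv₀.symm.surjective y
  obtain ⟨ψ, hψ⟩ := h φ.hom
  have : φ = ModuleCat.ofHom f ≫ ModuleCat.ofHom ψ := by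
    ext1; exact hψ.symm
  rw [this, Ext.addEquiv₀_symm_apply, ← Ext.mk₀_comp_mk₀]
  exact (ModuleCat.shortExact_of_exact hf hfg hg).extClass_comp_assoc _

theorem exists_lift (h : ExtVanish R 1 X A) (φ : X →ₗ[R] C) :
    ∃ ψ : X →ₗ[R] B, g ∘ₗ ψ = φ := by
  rw [iff_forall] at h
  obtain ⟨y, hy⟩ := Ext.covariant_sequence_exact₃ (ModuleCat.of R X)
    (ModuleCat.shortExact_of_exact hf hfg hg)
    (Ext.mk₀ (ModuleCat.ofHom φ)) (zero_add 1) (h _)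
  obtain ⟨ψ, rfl⟩ := Ext.addEquiv₀.symm.surjective y
  refine ⟨ψ.hom, ?_⟩
  simp only [Ext.addEquiv₀_symm_apply, Ext.mk₀_comp_mk₀] at hy
  have := Ext.addEquiv₀.symm.injective hy
  exact congrArg ModuleCat.Hom.hom this

end

theorem of_sum_comp_eq_id {ι : Type} [Fintype ι] {D : ι → Type} [∀ i, AddCommGroup (D i)]
    [∀ i, Module R (D i)] (p : ∀ i, Y →ₗ[R] D i) (s : ∀ i, D i →ₗ[R] Y)
    (hsp : ∑ i, s i ∘ₗ p i = LinearMap.id) {j : ℕ} (h : ∀ i, ExtVanish R j X (D i)) :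
    ExtVanish R j X Y := by
  simp only [iff_forall] at *
  intro x
  have h₁ : x = x.comp (Ext.mk₀ (∑ i, ModuleCat.ofHom (p i) ≫ ModuleCat.ofHom (s i)))
      (add_zero j) := by
    have : ∑ i, ModuleCat.ofHom (p i) ≫ ModuleCat.ofHom (s i) = 𝟙 (ModuleCat.of R Y) := by
      ext1
      simp only [ModuleCat.hom_sum, ModuleCat.hom_comp, ModuleCat.hom_ofHom, hsp]
      rfl
    rw [this, Ext.comp_mk₀_id]
  rw [h₁, Ext.mk₀_sum, Ext.comp_sum]
  refine Finset.sum_eq_zero fun i _ => ?_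
  rw [← Ext.mk₀_comp_mk₀, ← Ext.comp_assoc_of_third_deg_zero, h i (x.comp _ _), Ext.zero_comp]

theorem smul_eq_mk₀_comp {j : ℕ} (a : R)
    (x : Abelian.Ext (ModuleCat.of R X) (ModuleCat.of R Y) j) :
    a • x = (Ext.mk₀ (a • 𝟙 (ModuleCat.of R X))).comp x (zero_add j) := by
  rw [Ext.mk₀_smul, Ext.smul_comp, Ext.mk₀_id_comp]

/-- If multiplication by `a` on `X` is such that it kills a class after precomposition, and
`a` acts invertibly on `Y`, then the class vanishes. -/
theorem of_smul_eq_zero {j : ℕ} (a : R)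
    (hX : ∀ x : Abelian.Ext (ModuleCat.of R X) (ModuleCat.of R Y) j, a • x = 0)
    (hY : Function.Bijective (LinearMap.lsmul R Y a)) : ExtVanish R j X Y := by
  rw [iff_forall] at *
  intro x
  let e := LinearEquiv.ofBijective _ hY
  have h₁ : x = x.comp (Ext.mk₀ (ModuleCat.ofHom e.symm.toLinearMap ≫
      ModuleCat.ofHom e.toLinearMap)) (add_zero j) := by
    rw [← ModuleCat.ofHom_comp, e.comp_symm]
    exact (Ext.comp_mk₀_id x).symm
  have h₂ : ModuleCat.ofHom e.toLinearMap = a • 𝟙 (ModuleCat.of R Y) := by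
    ext; rfl
  rw [h₁, h₂, Linear.comp_smul, Category.comp_id, Ext.mk₀_smul, Ext.comp_smul, hX]

theorem of_factor {F : Type} [AddCommGroup F] [Module R F] [Module.Projective R F] {j : ℕ} (a : R)
    (u : X →ₗ[R] F) (q : F →ₗ[R] X) (hqu : q ∘ₗ u = a • LinearMap.id)
    (hY : Function.Bijective (LinearMap.lsmul R Y a)) : ExtVanish R (j + 1) X Y := by
  refine of_smul_eq_zero a (fun x => ?_) hY
  have h₂ : a • 𝟙 (ModuleCat.of R X) = ModuleCat.ofHom u ≫ ModuleCat.ofHom q := by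
    ext1; exact hqu.symm
  rw [smul_eq_mk₀_comp, h₂, ← Ext.mk₀_comp_mk₀_assoc]
  rw [Ext.eq_zero_of_projective ((Ext.mk₀ (ModuleCat.ofHom q)).comp x _), Ext.comp_zero]

theorem smul_eq_zero_of_left {j : ℕ} (a : R) (ha : ∀ x : X, a • x = 0)
    (x : Abelian.Ext (ModuleCat.of R X) (ModuleCat.of R Y) j) : a • x = 0 := by
  have h₂ : a • 𝟙 (ModuleCat.of R X) = 0 := by
    ext x; exact ha x
  rw [smul_eq_mk₀_comp, h₂, Ext.mk₀_zero, Ext.zero_comp]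

theorem of_smul_eq_zero_left {j : ℕ} (a : R) (ha : ∀ x : X, a • x = 0)
    (hY : Function.Bijective (LinearMap.lsmul R Y a)) : ExtVanish R j X Y :=
  of_smul_eq_zero a (smul_eq_zero_of_left a ha) hY

end ExtVanish
end

section
variable {R : Type} [CommRing R]

theorem exists_comp_eq_of_ker_le {F M X : Type} [AddCommGroup F] [Module R F] [AddCommGroup M]
    [Module R M] [AddCommGroup X] [Module R X] {π : F →ₗ[R] M} (hπ : Function.Surjective π)
    {f : F →ₗ[R] X} (h : LinearMap.ker π ≤ LinearMap.ker f) : ∃ g : M →ₗ[R] X, g ∘ₗ π = f := by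
  let e := LinearMap.quotKerEquivOfSurjective π hπ
  refine ⟨(LinearMap.ker π).liftQ f h ∘ₗ e.symm.toLinearMap, LinearMap.ext fun x => ?_⟩
  have : e.symm (π x) = Submodule.Quotient.mk x := by
    rw [LinearEquiv.symm_apply_eq]; rfl
  simp only [LinearMap.comp_apply, LinearEquiv.coe_coe, this]
  rfl

variable [IsLocalRing R]

theorem exists_smul_eq_zero_of_not_extVanish {A : Type} [AddCommGroup A] [Module R A]
    (h : ¬ ExtVanish R 0 (R ⧸ maximalIdeal R) A) :
    ∃ z : A, z ≠ 0 ∧ ∀ a ∈ maximalIdeal R, a • z = 0 := by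
  rw [ExtVanish.zero_iff] at h
  push Not at h
  obtain ⟨f, hf⟩ := h
  refine ⟨f (Ideal.Quotient.mk _ 1), fun h0 => hf ?_, fun a ha => ?_⟩
  · ext
    exact h0
  · rw [← map_smul]
    convert map_zero f
    exact Ideal.Quotient.eq_zero_iff_mem.2 (by simpa using ha)

theorem exists_residue_linearMap {A : Type} [AddCommGroup A] [Module R A] {z : A}
    (hz : ∀ a ∈ maximalIdeal R, a • z = 0) :
    ∃ ρ : (R ⧸ maximalIdeal R) →ₗ[R] A, ∀ r : R, ρ (Submodule.Quotient.mk r) = r • z :=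
  ⟨(maximalIdeal R).liftQ (LinearMap.toSpanSingleton R A z) (fun a ha => hz a ha), fun _ => rfl⟩

theorem eq_zero_of_extVanish_zero {A : Type} [AddCommGroup A] [Module R A]
    (h : ExtVanish R 0 (R ⧸ maximalIdeal R) A) {z : A}
    (hz : ∀ a ∈ maximalIdeal R, a • z = 0) : z = 0 := by
  rw [ExtVanish.zero_iff] at h
  obtain ⟨ρ, hρ⟩ := exists_residue_linearMap hz
  simpa [h ρ] using (hρ 1).symm

/-- A linear map detecting an element outside `𝔪 M`, with values in the line spanned by a socle
element. -/
theorem exists_linearMap_apply_ne_zero {M A : Type} [AddCommGroup M] [Module R M] [AddCommGroup A]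
    [Module R A] {z : A} (hz : z ≠ 0) (hz' : ∀ a ∈ maximalIdeal R, a • z = 0) {m : M}
    (hm : m ∉ maximalIdeal R • (⊤ : Submodule R M)) :
    ∃ g : M →ₗ[R] A, g m ≠ 0 ∧ ∀ a ∈ maximalIdeal R, a • g = 0 := by
  let _ : Field (R ⧸ maximalIdeal R) := Ideal.Quotient.field _
  let V := M ⧸ maximalIdeal R • (⊤ : Submodule R M)
  have hv : (Submodule.Quotient.mk m : V) ≠ 0 := by
    rwa [Ne, Submodule.Quotient.mk_eq_zero]
  obtain ⟨φ, hφ⟩ : ∃ φ : Module.Dual (R ⧸ maximalIdeal R) V, φ (Submodule.Quotient.mk m) = 1 := by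
    obtain ⟨φ, hφ⟩ := not_forall.1 (mt (Module.forall_dual_apply_eq_zero_iff
      (R ⧸ maximalIdeal R) (Submodule.Quotient.mk m : V)).1 hv)
    exact ⟨(φ (Submodule.Quotient.mk m))⁻¹ • φ, by simp [hφ]⟩
  obtain ⟨ρ, hρ⟩ := exists_residue_linearMap hz'
  refine ⟨ρ ∘ₗ φ.restrictScalars R ∘ₗ (maximalIdeal R • (⊤ : Submodule R M)).mkQ, ?_,
    fun a ha => ?_⟩
  · have : φ ((maximalIdeal R • (⊤ : Submodule R M)).mkQ m) = Submodule.Quotient.mk 1 := hφ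
    simpa only [LinearMap.comp_apply, LinearMap.restrictScalars_apply, this, hρ, one_smul]
  · ext x
    obtain ⟨r, hr⟩ := Submodule.Quotient.mk_surjective _
      (φ ((maximalIdeal R • (⊤ : Submodule R M)).mkQ x))
    simp only [LinearMap.smul_apply, LinearMap.comp_apply,
      LinearMap.restrictScalars_apply, ← hr, LinearMap.zero_apply, hρ]
    rw [smul_comm, hz' a ha, smul_zero]

theorem mem_smul_top_of_extVanish_one {M A : Type} [AddCommGroup M] [Module R M]
    [AddCommGroup A] [Module R A] {a b : ℕ} {δ : (Fin b → R) →ₗ[R] (Fin a → R)}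
    {π : (Fin a → R) →ₗ[R] M} (hδ : Function.Exact δ π) (hπ : Function.Surjective π)
    (hA : ¬ ExtVanish R 0 (R ⧸ maximalIdeal R) A)
    (hT : ExtVanish R 1 (Module.Dual R (Fin b → R) ⧸ LinearMap.range δ.dualMap) (M →ₗ[R] A))
    {m : M} (hm : ∀ f : Module.Dual R M, f m ∈ maximalIdeal R) :
    m ∈ maximalIdeal R • (⊤ : Submodule R M) := by
  by_contra hcon
  obtain ⟨z, hz, hz'⟩ := exists_smul_eq_zero_of_not_extVanish hA
  obtain ⟨g, hg, hg'⟩ := exists_linearMap_apply_ne_zero hz hz' hcon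
  obtain ⟨m', rfl⟩ := hπ m
  let φ₀ : Module.Dual R (Fin a → R) →ₗ[R] (M →ₗ[R] A) :=
    (LinearMap.toSpanSingleton R _ g) ∘ₗ (LinearMap.applyₗ m')
  have hφ₀ : LinearMap.ker δ.dualMap ≤ LinearMap.ker φ₀ := by
    intro f hf
    rw [LinearMap.mem_ker] at hf ⊢
    have hker : LinearMap.ker π ≤ LinearMap.ker f := by
      rw [LinearMap.exact_iff.1 hδ]
      rintro _ ⟨x, rfl⟩
      exact LinearMap.congr_fun hf x
    obtain ⟨f', rfl⟩ := exists_comp_eq_of_ker_le hπ hker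
    exact hg' _ (hm f')
  let θ : LinearMap.range δ.dualMap →ₗ[R] (M →ₗ[R] A) :=
    (LinearMap.ker δ.dualMap).liftQ φ₀ hφ₀ ∘ₗ δ.dualMap.quotKerEquivRange.symm.toLinearMap
  obtain ⟨ψ, hψ⟩ := ExtVanish.exists_extension
    (A := LinearMap.range δ.dualMap) (f := (LinearMap.range δ.dualMap).subtype)
    (g := (LinearMap.range δ.dualMap).mkQ)
    (Submodule.injective_subtype _) (LinearMap.exact_subtype_mkQ _) (Submodule.mkQ_surjective _)
    hT θ
  have key : ∀ f : Module.Dual R (Fin a → R), ψ (f ∘ₗ δ) = f m' • g := by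
    intro f
    have := LinearMap.congr_fun hψ ⟨δ.dualMap f, f, rfl⟩
    have h2 : δ.dualMap.quotKerEquivRange.symm ⟨δ.dualMap f, f, rfl⟩ = Submodule.Quotient.mk f := by
      rw [LinearEquiv.symm_apply_eq]; rfl
    simp only [θ, LinearMap.comp_apply, LinearEquiv.coe_coe, h2] at this
    exact this
  apply hg
  have h₁ : ∀ x : Fin a → R, x = ∑ j, x j • Pi.single (M := fun _ => R) j 1 := fun x => by
    simpa using pi_eq_sum_univ' x
  have h₂ : ∀ j, (LinearMap.proj j ∘ₗ δ : Module.Dual R (Fin b → R)) =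
      ∑ i, δ (Pi.single i 1) j • LinearMap.proj (φ := fun _ => R) i := by
    intro j
    ext i
    simp [Pi.single_apply]
  calc g (π m') = ∑ j, (m' j • g) (π (Pi.single j 1)) := by
        conv_lhs => rw [h₁ m']
        simp
    _ = ∑ j, ψ (LinearMap.proj j ∘ₗ δ) (π (Pi.single j 1)) := by
        simp only [key, LinearMap.proj_apply]
    _ = ∑ i, ψ (LinearMap.proj i) (π (δ (Pi.single i 1))) := by
        simp only [h₂, map_sum, LinearMap.sum_apply, map_smul, LinearMap.smul_apply]
        rw [Finset.sum_comm]
        refine Finset.sum_congr rfl fun i _ => ?_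
        conv_rhs => rw [h₁ (δ (Pi.single i 1))]
        simp only [map_sum, map_smul]
    _ = 0 := by simp [hδ.apply_apply_eq_zero]

end

section
variable {R : Type} [CommRing R]

theorem lsmul_bijective_localizedModule_powers (A : Type) [AddCommGroup A] [Module R A] (a : R) :
    Function.Bijective (LinearMap.lsmul R (LocalizedModule (Submonoid.powers a) A) a) :=
  (Module.End.isUnit_iff _).1 (IsLocalizedModule.map_units
    (LocalizedModule.mkLinearMap (Submonoid.powers a) A) ⟨a, Submonoid.mem_powers a⟩)

theorem lsmul_bijective_linearMap (M : Type) {A : Type} [AddCommGroup M] [Module R M]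
    [AddCommGroup A] [Module R A] {a : R} (h : Function.Bijective (LinearMap.lsmul R A a)) :
    Function.Bijective (LinearMap.lsmul R (M →ₗ[R] A) a) := by
  refine ⟨fun f g hfg => LinearMap.ext fun x => h.1 (LinearMap.congr_fun hfg x), fun f => ?_⟩
  refine ⟨(LinearEquiv.ofBijective _ h).symm.toLinearMap ∘ₗ f, LinearMap.ext fun x => ?_⟩
  exact (LinearEquiv.ofBijective _ h).apply_symm_apply (f x)

/-- Multiplication by `a` on `M` factors through a finite free module. -/
def FactorsThroughFree (M : Type) [AddCommGroup M] [Module R M] (a : R) : Prop :=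
  ∃ (n : ℕ) (u : M →ₗ[R] (Fin n → R)) (q : (Fin n → R) →ₗ[R] M),
    q ∘ₗ u = a • LinearMap.id

theorem FactorsThroughFree.extVanish {X Y : Type} [AddCommGroup X] [Module R X]
    [AddCommGroup Y] [Module R Y] {a : R} (h : FactorsThroughFree X a)
    (hY : Function.Bijective (LinearMap.lsmul R Y a)) (j : ℕ) : ExtVanish R (j + 1) X Y := by
  obtain ⟨n, u, q, huq⟩ := h
  exact ExtVanish.of_factor a u q huq hY

variable [IsLocalRing R]

theorem eq_zero_of_pow_smul_eq_zero {A : Type} [AddCommGroup A] [Module R A]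
    (h : ExtVanish R 0 (R ⧸ maximalIdeal R) A) (s : ℕ) {z : A}
    (hz : ∀ a ∈ maximalIdeal R ^ s, a • z = 0) : z = 0 := by
  induction s generalizing z with
  | zero => simpa using hz 1 (by simp)
  | succ s ih =>
    refine ih fun a ha => eq_zero_of_extVanish_zero h fun b hb => ?_
    rw [smul_smul]
    exact hz _ (by rw [pow_succ']; exact Ideal.mul_mem_mul hb ha)

theorem exists_shift_target {M T A : Type} [AddCommGroup M] [Module R M] [AddCommGroup T]
    [Module R T] [AddCommGroup A] [Module R A] [IsNoetherianRing R] {ι : Type} [Fintype ι]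
    (a : ι → R) (ham : ∀ i, a i ∈ maximalIdeal R)
    (hrad : maximalIdeal R ≤ (Ideal.span (Set.range a)).radical)
    (haM : ∀ i, FactorsThroughFree M (a i)) (haT : ∀ i, FactorsThroughFree T (a i))
    {h : ℕ} (hk : ∀ i < h + 1, ExtVanish R i (R ⧸ maximalIdeal R) A)
    (hk' : ¬ ExtVanish R (h + 1) (R ⧸ maximalIdeal R) A)
    (hM : ∀ i, 1 ≤ i → i ≤ h + 1 → ExtVanish R i M A)
    (hT : ExtVanish R (h + 2) T (M →ₗ[R] A)) :
    ∃ (A' : Type) (_ : AddCommGroup A') (_ : Module R A'),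
      (∀ i < h, ExtVanish R i (R ⧸ maximalIdeal R) A') ∧
      (¬ ExtVanish R h (R ⧸ maximalIdeal R) A') ∧
      (∀ i, 1 ≤ i → i ≤ h → ExtVanish R i M A') ∧ ExtVanish R (h + 1) T (M →ₗ[R] A') := by
  classical
  let D : ι → Type := fun i => LocalizedModule (Submonoid.powers (a i)) A
  have hD : ∀ i, Function.Bijective (LinearMap.lsmul R (D i) (a i)) := fun i =>
    lsmul_bijective_localizedModule_powers A (a i)
  have hsum : ∑ i, LinearMap.single R D i ∘ₗ LinearMap.proj i = LinearMap.id := by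
    ext x j
    simp [Finset.sum_apply]
  have hB₁ : ∀ i, ExtVanish R i (R ⧸ maximalIdeal R) (∀ i, D i) := fun j =>
    ExtVanish.of_sum_comp_eq_id _ _ hsum fun i => ExtVanish.of_smul_eq_zero_left (a i)
      (fun x => by
        obtain ⟨r, rfl⟩ := Submodule.Quotient.mk_surjective _ x
        exact (Submodule.Quotient.mk_eq_zero _).2 (Ideal.mul_mem_right _ _ (ham i))) (hD i)
  have hB₂ : ∀ i, ExtVanish R (i + 1) M (∀ i, D i) := fun j =>
    ExtVanish.of_sum_comp_eq_id _ _ hsum fun i => (haM i).extVanish (hD i) j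
  have hB₃ : ∀ i, ExtVanish R (i + 1) T (M →ₗ[R] (∀ i, D i)) := fun j =>
    ExtVanish.of_sum_comp_eq_id (D := fun i => M →ₗ[R] D i)
      (fun i => LinearMap.compRight R (LinearMap.proj i))
      (fun i => LinearMap.compRight R (LinearMap.single R D i)) (by
        ext f x j
        simp)
      fun i => (haT i).extVanish (lsmul_bijective_linearMap M (hD i)) j
  let f : A →ₗ[R] (∀ i, D i) :=
    LinearMap.pi fun i => LocalizedModule.mkLinearMap (Submonoid.powers (a i)) A
  have hf : Function.Injective f := by
    rw [injective_iff_map_eq_zero]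
    intro x hx
    let J : Ideal R := LinearMap.ker (LinearMap.toSpanSingleton R A x)
    have hJ : maximalIdeal R ≤ J.radical := by
      refine hrad.trans ?_
      rw [Ideal.radical_le_radical_iff, Ideal.span_le]
      rintro _ ⟨i, rfl⟩
      have hxi : LocalizedModule.mkLinearMap (Submonoid.powers (a i)) A x = 0 := congr_fun hx i
      rw [IsLocalizedModule.eq_zero_iff (Submonoid.powers (a i))] at hxi
      obtain ⟨⟨_, n, rfl⟩, hc⟩ := hxi
      exact ⟨n, hc⟩
    obtain ⟨s, hs⟩ := Ideal.exists_pow_le_of_le_radical_of_fg hJ (IsNoetherian.noetherian _)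
    exact eq_zero_of_pow_smul_eq_zero (hk 0 (by lia)) s fun b hb => hs hb
  let A' := (∀ i, D i) ⧸ LinearMap.range f
  let g : (∀ i, D i) →ₗ[R] A' := (LinearMap.range f).mkQ
  have hfg : Function.Exact f g := by
    rw [LinearMap.exact_iff]; exact Submodule.ker_mkQ _
  have hg : Function.Surjective g := Submodule.mkQ_surjective _
  refine ⟨A', inferInstance, inferInstance, fun i hi => ?_, fun h0 => hk' ?_,
    fun i hi₁ hi₂ => ?_, ?_⟩
  · exact ExtVanish.covariant_right hf hfg hg (hB₁ i) (hk (i + 1) (by lia))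
  · exact ExtVanish.covariant_left hf hfg hg h0 (hB₁ _)
  · obtain ⟨i, rfl⟩ := Nat.exists_eq_add_of_le' hi₁
    exact ExtVanish.covariant_right hf hfg hg (hB₂ i) (hM _ (by lia) (by lia))
  · refine ExtVanish.covariant_right (A := M →ₗ[R] A) (f := LinearMap.compRight R f)
      (g := LinearMap.compRight R g) ?_ ?_ ?_ (hB₃ h) hT
    · intro φ ψ hφψ
      exact LinearMap.ext fun x => hf (LinearMap.congr_fun hφψ x)
    · intro φ
      refine ⟨fun hφ => ?_, ?_⟩
      · have : ∀ x, φ x ∈ LinearMap.range f := fun x =>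
          (hfg (φ x)).1 (LinearMap.congr_fun hφ x)
        let e := LinearEquiv.ofInjective f hf
        refine ⟨e.symm.toLinearMap ∘ₗ φ.codRestrict _ this, LinearMap.ext fun x => ?_⟩
        exact congrArg Subtype.val (e.apply_symm_apply (φ.codRestrict _ this x))
      · rintro ⟨ψ, rfl⟩
        exact LinearMap.ext fun x => hfg.apply_apply_eq_zero (ψ x)
    · intro φ
      exact ExtVanish.exists_lift hf hfg hg (hM 1 le_rfl (by lia)) φ

theorem mem_smul_top_of_extVanish {M A : Type} [AddCommGroup M] [Module R M]
    [AddCommGroup A] [Module R A] [IsNoetherianRing R]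
    {m n : ℕ} {δ : (Fin n → R) →ₗ[R] (Fin m → R)}
    {π : (Fin m → R) →ₗ[R] M} (hδ : Function.Exact δ π) (hπ : Function.Surjective π)
    {ι : Type} [Fintype ι] (a : ι → R) (ham : ∀ i, a i ∈ maximalIdeal R)
    (hrad : maximalIdeal R ≤ (Ideal.span (Set.range a)).radical)
    (haM : ∀ i, FactorsThroughFree M (a i))
    (haT : ∀ i, FactorsThroughFree
      (Module.Dual R (Fin n → R) ⧸ LinearMap.range δ.dualMap) (a i))
    (h : ℕ) (hk : ∀ i < h, ExtVanish R i (R ⧸ maximalIdeal R) A)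
    (hk' : ¬ ExtVanish R h (R ⧸ maximalIdeal R) A)
    (hM : ∀ i, 1 ≤ i → i ≤ h → ExtVanish R i M A)
    (hT : ExtVanish R (h + 1) (Module.Dual R (Fin n → R) ⧸ LinearMap.range δ.dualMap)
      (M →ₗ[R] A))
    {x : M} (hx : ∀ f : Module.Dual R M, f x ∈ maximalIdeal R) :
    x ∈ maximalIdeal R • (⊤ : Submodule R M) := by
  induction h generalizing A with
  | zero => exact mem_smul_top_of_extVanish_one hδ hπ hk' hT hx
  | succ h ih =>
    obtain ⟨A', _, _, h₁, h₂, h₃, h₄⟩ := exists_shift_target a ham hrad haM haT hk hk' hM hT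
    exact ih h₁ h₂ h₃ h₄

end

section
variable {R : Type} [CommRing R]

/-- The ideal of elements `a` such that multiplication by `a` on `M` factors through `π`. -/
def factorIdeal {F M : Type} [AddCommGroup F] [Module R F] [AddCommGroup M] [Module R M]
    (π : F →ₗ[R] M) : Ideal R where
  carrier := {a | ∃ s : M →ₗ[R] F, π ∘ₗ s = a • LinearMap.id}
  add_mem' := by
    rintro a b ⟨s, hs⟩ ⟨t, ht⟩
    exact ⟨s + t, by rw [LinearMap.comp_add, hs, ht, add_smul]⟩
  zero_mem' := ⟨0, by simp⟩
  smul_mem' := by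
    rintro c a ⟨s, hs⟩
    exact ⟨c • s, by rw [LinearMap.comp_smul, hs, smul_smul, smul_eq_mul]⟩

theorem factorsThroughFree_quotient_range_dualMap {M : Type} [AddCommGroup M] [Module R M]
    {m n : ℕ} {δ : (Fin n → R) →ₗ[R] (Fin m → R)}
    {π : (Fin m → R) →ₗ[R] M} (hδ : Function.Exact δ π) {a : R} (ha : a ∈ factorIdeal π) :
    FactorsThroughFree (Module.Dual R (Fin n → R) ⧸ LinearMap.range δ.dualMap) a := by
  obtain ⟨s, hs⟩ := ha
  have hmem : ∀ x, (a • (LinearMap.id : (Fin m → R) →ₗ[R] _) - s ∘ₗ π) x ∈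
      LinearMap.range δ := fun x => by
    rw [← LinearMap.exact_iff.1 hδ, LinearMap.mem_ker]
    have := LinearMap.congr_fun hs (π x)
    simp only [LinearMap.comp_apply, LinearMap.smul_apply, LinearMap.id_apply] at this
    simp [this]
  obtain ⟨k, hk⟩ := Module.projective_lifting_property δ.rangeRestrict
    ((a • LinearMap.id - s ∘ₗ π).codRestrict _ hmem) δ.surjective_rangeRestrict
  have hk' : δ ∘ₗ k = a • LinearMap.id - s ∘ₗ π :=
    LinearMap.ext fun x => congrArg Subtype.val (LinearMap.congr_fun hk x)
  have hk'' : δ ∘ₗ k ∘ₗ δ = a • δ := by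
    rw [← LinearMap.comp_assoc, hk', LinearMap.sub_comp, LinearMap.comp_assoc,
      hδ.linearMap_comp_eq_zero]
    simp [LinearMap.smul_comp]
  let u : Module.Dual R (Fin n → R) →ₗ[R] Module.Dual R (Fin n → R) :=
    a • LinearMap.id - δ.dualMap ∘ₗ k.dualMap
  have hu : LinearMap.range δ.dualMap ≤ LinearMap.ker u := by
    rintro _ ⟨f, rfl⟩
    rw [LinearMap.mem_ker]
    refine LinearMap.ext fun x => ?_
    have := congrArg f (LinearMap.congr_fun hk'' x)
    simp only [LinearMap.comp_apply, LinearMap.smul_apply, map_smul] at this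
    simp [u, this]
  let e : (Fin n → R) ≃ₗ[R] Module.Dual R (Fin n → R) := (Pi.basisFun R (Fin n)).toDualEquiv
  refine ⟨n, e.symm.toLinearMap ∘ₗ (LinearMap.range δ.dualMap).liftQ u hu,
    (LinearMap.range δ.dualMap).mkQ ∘ₗ e.toLinearMap, ?_⟩
  ext1
  ext1 f
  simp only [LinearMap.comp_apply, LinearEquiv.coe_coe, e.apply_symm_apply, Submodule.mkQ_apply,
    Submodule.liftQ_apply, LinearMap.smul_apply, LinearMap.id_apply]
  rw [← Submodule.Quotient.mk_smul, Submodule.Quotient.eq]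
  exact ⟨-k.dualMap f, by simp [u]⟩

variable [IsLocalRing R]

theorem free_of_one_mem_factorIdeal {F M : Type} [AddCommGroup F] [Module R F] [AddCommGroup M]
    [Module R M] [Module.Projective R F] [Module.Finite R M] {π : F →ₗ[R] M}
    (h : 1 ∈ factorIdeal π) : Module.Free R M := by
  obtain ⟨s, hs⟩ := h
  have := Module.Projective.of_split s π (by simpa using hs)
  exact Module.free_of_flat_of_isLocalRing

theorem exists_one_tmul_eq {M : Type} [AddCommGroup M] [Module R M] (x : ResidueField R ⊗[R] M) :
    ∃ y : M, (1 : ResidueField R) ⊗ₜ[R] y = x := by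
  induction x using TensorProduct.induction_on with
  | zero => exact ⟨0, by simp⟩
  | tmul c z =>
    obtain ⟨r, rfl⟩ := residue_surjective c
    refine ⟨r • z, ?_⟩
    rw [← TensorProduct.smul_tmul, Algebra.smul_def, mul_one]
    rfl
  | add x y h₁ h₂ =>
    obtain ⟨z, rfl⟩ := h₁
    obtain ⟨w, rfl⟩ := h₂
    exact ⟨z + w, TensorProduct.tmul_add _ _ _⟩

theorem free_of_forall_dual [IsNoetherianRing R] {M : Type} [AddCommGroup M] [Module R M]
    [Module.Finite R M]
    (h : ∀ x : M, (∀ f : Module.Dual R M, f x ∈ maximalIdeal R) →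
      x ∈ maximalIdeal R • (⊤ : Submodule R M)) : Module.Free R M := by
  obtain ⟨n, f, hf⟩ := Module.Finite.exists_fin (R := R) (M := Module.Dual R M)
  let Φ : M →ₗ[R] (Fin n → R) := LinearMap.pi f
  have hΦ : Function.Injective (Φ.lTensor (ResidueField R)) := by
    rw [injective_iff_map_eq_zero]
    intro x hx
    obtain ⟨y, rfl⟩ := exists_one_tmul_eq x
    have hy : ∀ g : Module.Dual R M, g y ∈ maximalIdeal R := by
      intro g
      have hg : g ∈ Submodule.span R (Set.range f) := hf ▸ Submodule.mem_top
      induction hg using Submodule.span_induction with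
      | mem g hg =>
        obtain ⟨j, rfl⟩ := hg
        have := congrArg ((LinearMap.proj j : (Fin n → R) →ₗ[R] R).lTensor (ResidueField R)) hx
        have := congrArg (TensorProduct.rid R (ResidueField R)) this
        simp only [LinearMap.lTensor_tmul, map_zero,
          TensorProduct.rid_tmul, Φ, LinearMap.proj_apply, LinearMap.pi_apply] at this
        rw [← residue_eq_zero_iff, ← this, Algebra.smul_def, mul_one]
        rfl
      | zero => simp
      | add g g' _ _ h₁ h₂ => exact add_mem h₁ h₂
      | smul c g _ h₁ => exact Ideal.mul_mem_left _ c h₁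
    refine Submodule.smul_induction_on (p := fun y => (1 : ResidueField R) ⊗ₜ[R] y = 0) (h y hy)
      (fun a ha z _ => ?_) (fun z w h₁ h₂ => by rw [TensorProduct.tmul_add, h₁, h₂, add_zero])
    rw [← TensorProduct.smul_tmul, Algebra.smul_def, mul_one]
    change residue R a ⊗ₜ[R] z = 0
    rw [(residue_eq_zero_iff a).2 ha, TensorProduct.zero_tmul]
  obtain ⟨l, hl⟩ := (IsLocalRing.split_injective_iff_lTensor_residueField_injective Φ).2 hΦ
  have := Module.Projective.of_split Φ l hl
  exact Module.free_of_flat_of_isLocalRing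

theorem free_of_extVanish_dual [IsNoetherianRing R] {M A : Type} [AddCommGroup M] [Module R M]
    [Module.Finite R M] [AddCommGroup A] [Module R A] {m : ℕ} {π : (Fin m → R) →ₗ[R] M}
    (hπ : Function.Surjective π) (hrad : maximalIdeal R ≤ (factorIdeal π).radical) {h : ℕ}
    (hk : ∀ i < h + 2, ExtVanish R i (R ⧸ maximalIdeal R) A)
    (hk' : ¬ ExtVanish R (h + 2) (R ⧸ maximalIdeal R) A)
    (hM : ∀ i, 1 ≤ i → i ≤ h + 2 → ExtVanish R i M A)
    (hD : ExtVanish R (h + 1) (Module.Dual R M) (M →ₗ[R] A)) : Module.Free R M := by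
  by_cases htop : factorIdeal π = ⊤
  · exact free_of_one_mem_factorIdeal (htop ▸ Submodule.mem_top)
  obtain ⟨n, p, hp⟩ := Module.Finite.exists_fin' R (LinearMap.ker π)
  let δ : (Fin n → R) →ₗ[R] (Fin m → R) := (LinearMap.ker π).subtype ∘ₗ p
  have hδ : Function.Exact δ π := by
    rw [LinearMap.exact_iff, LinearMap.range_comp, LinearMap.range_eq_top.2 hp]
    simp
  obtain ⟨S, hS⟩ := (IsNoetherian.noetherian (factorIdeal π) : (factorIdeal π).FG)
  have hmem : ∀ i : S, (i : R) ∈ factorIdeal π := fun i => hS ▸ Submodule.subset_span i.2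
  refine free_of_forall_dual fun x hx => mem_smul_top_of_extVanish hδ hπ (fun i : S => (i : R))
    (fun i => le_maximalIdeal htop (hmem i)) ?_ (fun i => ?_) (fun i =>
      factorsThroughFree_quotient_range_dualMap hδ (hmem i)) (h + 2) hk hk' hM ?_ hx
  · convert hrad
    rw [← hS, Subtype.range_coe_subtype]
    simp
  · obtain ⟨s, hs⟩ := hmem i
    exact ⟨m, s, π, hs⟩
  · have h₁ : ExtVanish R (h + 2) (LinearMap.range δ.dualMap) (M →ₗ[R] A) := by
      refine (ExtVanish.shift_iff (f := π.dualMap) (g := δ.dualMap.rangeRestrict) ?_ ?_ ?_).2 hD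
      · exact LinearMap.dualMap_injective_of_surjective hπ
      · intro f
        rw [← LinearMap.mem_ker, LinearMap.ker_rangeRestrict, LinearMap.mem_ker]
        refine ⟨fun hf => ?_, ?_⟩
        · have hker : LinearMap.ker π ≤ LinearMap.ker f := by
            rw [LinearMap.exact_iff.1 hδ]
            rintro _ ⟨x, rfl⟩
            exact LinearMap.congr_fun hf x
          obtain ⟨g, hg⟩ := exists_comp_eq_of_ker_le hπ hker
          exact ⟨g, hg⟩
        · rintro ⟨g, rfl⟩
          exact LinearMap.ext fun x => by simp [hδ.apply_apply_eq_zero]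
      · exact LinearMap.surjective_rangeRestrict _
    exact (ExtVanish.shift_iff (A := LinearMap.range δ.dualMap)
      (f := (LinearMap.range δ.dualMap).subtype)
      (g := (LinearMap.range δ.dualMap).mkQ)
      (Submodule.injective_subtype _) (LinearMap.exact_subtype_mkQ _)
      (Submodule.mkQ_surjective _)).2 h₁
end

section
variable {R : Type} [CommRing R]

/-- Projective dimension at most `n`, phrased as vanishing of Ext in degree `n + 1`. -/
def ExtDimLE (R : Type) [CommRing R] (n : ℕ) (M : Type) [AddCommGroup M] [Module R M] : Prop :=
  ∀ (Y : Type) [AddCommGroup Y] [Module R Y], ExtVanish R (n + 1) M Y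

theorem ExtDimLE.projective {M : Type} [AddCommGroup M] [Module R M] (h : ExtDimLE R 0 M) :
    Module.Projective R M := by
  let π : (M →₀ R) →ₗ[R] M := Finsupp.linearCombination R id
  have hπ : Function.Surjective π := Finsupp.linearCombination_id_surjective R M
  obtain ⟨s, hs⟩ := ExtVanish.exists_lift (A := LinearMap.ker π) (f := (LinearMap.ker π).subtype)
    (Submodule.injective_subtype _) (LinearMap.exact_subtype_ker_map π) hπ (h _)
    LinearMap.id
  exact Module.Projective.of_split s π hs

theorem ExtDimLE.of_projective {M : Type} [AddCommGroup M] [Module R M] [Module.Projective R M]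
    (n : ℕ) : ExtDimLE R n M := fun _ _ _ => ExtVanish.succ_of_projective n

theorem extDimLE_ker_iff {F M : Type} [AddCommGroup F] [Module R F] [AddCommGroup M] [Module R M]
    [Module.Projective R F] {π : F →ₗ[R] M} (hπ : Function.Surjective π) {n : ℕ} :
    ExtDimLE R n (LinearMap.ker π) ↔ ExtDimLE R (n + 1) M :=
  forall_congr' fun _ => forall_congr' fun _ => forall_congr' fun _ =>
    (ExtVanish.shift_iff (f := (LinearMap.ker π).subtype)
      (Submodule.injective_subtype _) (LinearMap.exact_subtype_ker_map π) hπ).symm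

theorem ExtDimLE.of_hasPdLE {n : ℕ} {M : Type} [AddCommGroup M] [Module R M]
    (h : hasPdLE R n M) : ExtDimLE R n M := by
  induction n generalizing M with
  | zero =>
    have : Module.Projective R M := h
    exact .of_projective 0
  | succ n ih =>
    obtain ⟨P, _, _, f, _, hf, hn⟩ := h
    exact (extDimLE_ker_iff hf).1 (ih hn)

theorem ExtVanish.pi_right {ι X Y : Type} [Fintype ι] [AddCommGroup X] [Module R X]
    [AddCommGroup Y] [Module R Y] {j : ℕ} (h : ExtVanish R j X Y) :
    ExtVanish R j X (ι → Y) := by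
  classical
  refine of_sum_comp_eq_id (D := fun _ : ι => Y) (fun i => LinearMap.proj i)
    (fun i => LinearMap.single R (fun _ => Y) i) ?_ fun _ => h
  ext x j
  simp [Finset.sum_apply]

theorem ExtVanish.zero_of_injective {X A B : Type} [AddCommGroup X] [Module R X]
    [AddCommGroup A] [Module R A] [AddCommGroup B] [Module R B] {f : A →ₗ[R] B}
    (hf : Function.Injective f) (h : ExtVanish R 0 X B) : ExtVanish R 0 X A := by
  rw [ExtVanish.zero_iff] at *
  intro g
  ext x
  exact hf (by simpa using LinearMap.congr_fun (h (f ∘ₗ g)) x)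

theorem extDimLE_zero_of_subsingleton_ker {F M : Type} [AddCommGroup F] [Module R F]
    [AddCommGroup M] [Module R M] [Module.Projective R F] {π : F →ₗ[R] M}
    (hπ : Function.Surjective π) (h : Subsingleton (LinearMap.ker π)) : ExtDimLE R 0 M := by
  have := Module.Projective.of_equiv (LinearEquiv.ofBijective π
    ⟨LinearMap.ker_eq_bot.1 ((Submodule.subsingleton_iff_eq_bot).1 h), hπ⟩)
  exact .of_projective 0

variable [IsLocalRing R]

theorem exists_minimal_cover (M : Type) [AddCommGroup M] [Module R M] [Module.Finite R M] :
    ∃ (n : ℕ) (π : (Fin n → R) →ₗ[R] M), Function.Surjective π ∧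
      ∀ x, π x = 0 → ∀ i, x i ∈ maximalIdeal R := by
  let b := Module.finBasis (ResidueField R) (ResidueField R ⊗[R] M)
  choose v hv using fun i => exists_one_tmul_eq (b i)
  refine ⟨_, Fintype.linearCombination R v, ?_, fun x hx i => ?_⟩
  · rw [← LinearMap.range_eq_top, Fintype.range_linearCombination]
    exact IsLocalRing.span_eq_top_of_tmul_eq_basis v b hv
  · rw [Fintype.linearCombination_apply] at hx
    have h₁ : ∑ i, residue R (x i) • b i = 0 := by
      have := congrArg (fun y : M => (1 : ResidueField R) ⊗ₜ[R] y) hx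
      simp only [TensorProduct.tmul_sum, TensorProduct.tmul_zero, TensorProduct.tmul_smul] at this
      rw [← this]
      refine Finset.sum_congr rfl fun i _ => ?_
      rw [hv]
      exact (algebraMap_smul (ResidueField R) (x i) (b i))
    exact (residue_eq_zero_iff _).1 (Fintype.linearIndependent_iff.1 b.linearIndependent _ h₁ i)

theorem comp_mk₀_eq_zero_of_range_le {G : Type} [AddCommGroup G] [Module R G] [Module.Finite R G]
    [Module.Free R G] {n : ℕ} {δ : G →ₗ[R] (Fin n → R)} (hδ : ∀ x i, δ x i ∈ maximalIdeal R)
    {j : ℕ} (x : Abelian.Ext (ModuleCat.of R (R ⧸ maximalIdeal R)) (ModuleCat.of R G) j) :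
    x.comp (Abelian.Ext.mk₀ (ModuleCat.ofHom δ)) (add_zero j) = 0 := by
  let b := Module.Free.chooseBasis R G
  have h₁ : δ = ∑ p : _ × _, δ (b p.1) p.2 • (LinearMap.single R (fun _ => R) p.2 ∘ₗ b.coord p.1) := by
    refine b.ext fun i => ?_
    ext l
    simp [Fintype.sum_prod_type, LinearMap.sum_apply, Finset.sum_apply, Pi.single_apply,
      Finsupp.single_apply]
  have h₂ : ModuleCat.ofHom δ = ∑ p : _ × _, δ (b p.1) p.2 •
      ModuleCat.ofHom (LinearMap.single R (fun _ => R) p.2 ∘ₗ b.coord p.1) := by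
    ext1
    simp only [ModuleCat.hom_sum, ModuleCat.hom_smul, ModuleCat.hom_ofHom]
    exact h₁
  rw [h₂, Abelian.Ext.mk₀_sum, Abelian.Ext.comp_sum]
  refine Finset.sum_eq_zero fun p _ => ?_
  rw [Abelian.Ext.mk₀_smul, Abelian.Ext.comp_smul, ← Abelian.Ext.smul_comp,
    ExtVanish.smul_eq_zero_of_left, Abelian.Ext.zero_comp]
  intro y
  obtain ⟨r, rfl⟩ := Submodule.Quotient.mk_surjective _ y
  exact (Submodule.Quotient.mk_eq_zero _).2 (Ideal.mul_mem_right _ _ (hδ _ _))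

theorem subsingleton_of_extVanish_free {G : Type} [AddCommGroup G] [Module R G] [Module.Finite R G]
    [Module.Free R G] {t : ℕ} (ht : ¬ ExtVanish R t (R ⧸ maximalIdeal R) R)
    (hG : ExtVanish R t (R ⧸ maximalIdeal R) G) : Subsingleton G := by
  let b := Module.Free.chooseBasis R G
  by_contra hcon
  rw [not_subsingleton_iff_nontrivial] at hcon
  obtain ⟨i⟩ := b.index_nonempty
  refine ht (ExtVanish.of_sum_comp_eq_id (ι := Unit) (D := fun _ => G)
    (fun _ => LinearMap.toSpanSingleton R G (b i)) (fun _ => b.coord i) ?_ fun _ => hG)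
  ext
  simp

theorem ker_free_of_extDimLE_one [IsNoetherianRing R] {F M : Type}
    [AddCommGroup F] [Module R F] [AddCommGroup M]
    [Module R M] [Module.Projective R F] [Module.Finite R F] {π : F →ₗ[R] M}
    (hπ : Function.Surjective π) (h : ExtDimLE R 1 M) : Module.Free R (LinearMap.ker π) := by
  have := ((extDimLE_ker_iff hπ).2 h).projective
  exact Module.free_of_flat_of_isLocalRing

theorem auslander_buchsbaum_of_extDimLE [IsNoetherianRing R] {t : ℕ}
    (ht : ∀ i < t, ExtVanish R i (R ⧸ maximalIdeal R) R)
    (ht' : ¬ ExtVanish R t (R ⧸ maximalIdeal R) R) (k : ℕ) {M : Type} [AddCommGroup M] [Module R M]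
    [Module.Finite R M] (h : ExtDimLE R (k + 1) M) (h' : ¬ ExtDimLE R k M) :
    ∃ s, t = s + k + 1 ∧ ¬ ExtVanish R s (R ⧸ maximalIdeal R) M := by
  induction k generalizing M with
  | zero =>
    obtain ⟨n, π, hπ, hmin⟩ := exists_minimal_cover (R := R) M
    have hfree := ker_free_of_extDimLE_one hπ h
    have hzero := fun j => comp_mk₀_eq_zero_of_range_le (j := j) (δ := (LinearMap.ker π).subtype)
      (fun x => hmin x x.2)
    have hne : ¬ ExtVanish R t (R ⧸ maximalIdeal R) (LinearMap.ker π) := fun h0 =>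
      h' (extDimLE_zero_of_subsingleton_ker hπ (subsingleton_of_extVanish_free ht' h0))
    cases t with
    | zero =>
      refine absurd (ExtVanish.zero_iff.2 fun f => ?_) hne
      have := hzero 0 (Abelian.Ext.mk₀ (ModuleCat.ofHom f))
      rw [Abelian.Ext.mk₀_comp_mk₀] at this
      have := (Abelian.Ext.mk₀_eq_zero_iff _).1 this
      exact LinearMap.ext fun x => Subtype.ext
        (LinearMap.congr_fun (congrArg ModuleCat.Hom.hom this) x)
    | succ t =>
      refine ⟨t, rfl, fun h0 => hne (ExtVanish.iff_forall.2 fun x => ?_)⟩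
      obtain ⟨y, rfl⟩ := Abelian.Ext.covariant_sequence_exact₁ _
        (ModuleCat.shortExact_of_exact (Submodule.injective_subtype _)
          (LinearMap.exact_subtype_ker_map π) hπ) x (hzero _ x) rfl
      rw [ExtVanish.iff_forall.1 h0 y, Abelian.Ext.zero_comp]
  | succ k ih =>
    obtain ⟨n, π, hπ⟩ := Module.Finite.exists_fin' R M
    obtain ⟨s, rfl, hs⟩ := ih ((extDimLE_ker_iff hπ).2 h) (mt (extDimLE_ker_iff hπ).1 h')
    have hF : ∀ i < s + k + 1, ExtVanish R i (R ⧸ maximalIdeal R) (Fin n → R) :=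
      fun i hi => (ht i hi).pi_right
    cases s with
    | zero => exact absurd ((hF 0 (by lia)).zero_of_injective (Submodule.injective_subtype _)) hs
    | succ s =>
      refine ⟨s, by lia, fun h0 => hs ?_⟩
      exact ExtVanish.covariant_left (Submodule.injective_subtype _)
          (LinearMap.exact_subtype_ker_map π) hπ h0 (hF _ (by lia))

theorem extDimLE_of_extVanish [IsNoetherianRing R] (k : ℕ) {M N : Type} [AddCommGroup M]
    [Module R M] [Module.Finite R M] [AddCommGroup N] [Module R N] [Module.Finite R N]
    [Nontrivial N] (h : ExtDimLE R (k + 1) M) (hN : ExtVanish R (k + 1) M N) : ExtDimLE R k M := by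
  induction k generalizing M with
  | zero =>
    obtain ⟨n, π, hπ, hmin⟩ := exists_minimal_cover (R := R) M
    have hfree := ker_free_of_extDimLE_one hπ h
    refine extDimLE_zero_of_subsingleton_ker hπ ?_
    by_contra hcon
    rw [not_subsingleton_iff_nontrivial] at hcon
    let b := Module.Free.chooseBasis R (LinearMap.ker π)
    obtain ⟨i⟩ := b.index_nonempty
    have htop : maximalIdeal R • (⊤ : Submodule R N) ≠ ⊤ := fun h0 =>
      top_ne_bot (α := Submodule R N) (Submodule.eq_bot_of_le_smul_of_le_jacobson_bot
        (maximalIdeal R) ⊤ Module.Finite.fg_top h0.ge (maximalIdeal_le_jacobson _))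
    obtain ⟨y, -, hy⟩ := SetLike.exists_of_lt (lt_top_iff_ne_top.2 htop)
    obtain ⟨ψ, hψ⟩ := ExtVanish.exists_extension (Submodule.injective_subtype _)
          (LinearMap.exact_subtype_ker_map π) hπ hN (b.constr R fun _ => y)
    apply hy
    have h₁ := LinearMap.congr_fun hψ (b i)
    rw [b.constr_basis] at h₁
    rw [← h₁, LinearMap.comp_apply, Submodule.subtype_apply, pi_eq_sum_univ' (b i : Fin n → R),
      map_sum]
    refine sum_mem fun j _ => ?_
    rw [map_smul]
    exact Submodule.smul_mem_smul (hmin _ (b i).2 j) trivial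
  | succ k ih =>
    obtain ⟨n, π, hπ⟩ := Module.Finite.exists_fin' R M
    refine (extDimLE_ker_iff hπ).1 (ih ((extDimLE_ker_iff hπ).2 h) ?_)
    exact (ExtVanish.shift_iff (Submodule.injective_subtype _)
          (LinearMap.exact_subtype_ker_map π) hπ).1 hN

theorem free_of_extDimLE_of_extVanish [IsNoetherianRing R] {t h : ℕ} (hth : t ≤ h)
    (ht : ∀ i < t, ExtVanish R i (R ⧸ maximalIdeal R) R)
    (ht' : ¬ ExtVanish R t (R ⧸ maximalIdeal R) R) (k : ℕ) {M N : Type} [AddCommGroup M]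
    [Module R M] [Module.Finite R M] [AddCommGroup N] [Module R N] [Module.Finite R N]
    [Nontrivial N] (hM : ExtDimLE R k M) (hN : ∀ i, 1 ≤ i → i ≤ h → ExtVanish R i M N) :
    Module.Free R M := by
  induction k with
  | zero =>
    have := hM.projective
    exact Module.free_of_flat_of_isLocalRing
  | succ k ih =>
    by_cases hk : ExtDimLE R k M
    · exact ih hk
    · obtain ⟨s, hs, -⟩ := auslander_buchsbaum_of_extDimLE ht ht' k hM hk
      exact ih (extDimLE_of_extVanish k hM (hN _ (by lia) (by lia)))

end

section

theorem exists_least_not_extVanish_self {R : Type} [CommRing R] [IsLocalRing R]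
    [IsNoetherianRing R] {h : ℕ} (hdim : ringKrullDim R = h) :
    ∃ t ≤ h, (∀ i < t, ExtVanish R i (R ⧸ maximalIdeal R) R) ∧
      ¬ ExtVanish R t (R ⧸ maximalIdeal R) R := by
  classical
  have hex : ∃ t, t ≤ h ∧ ¬ ExtVanish R t (R ⧸ maximalIdeal R) R := by
    by_contra! hall
    have hlt : maximalIdeal R • (⊤ : Submodule R R) < ⊤ := by
      rw [smul_eq_mul, Ideal.mul_top]
      exact lt_top_iff_ne_top.2 (Ideal.IsPrime.ne_top')
    have hs : Module.support R (R ⧸ maximalIdeal R) =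
        PrimeSpectrum.zeroLocus (maximalIdeal R : Set R) := by
      rw [Module.support_eq_zeroLocus, Ideal.annihilator_quotient]
    obtain ⟨rs, hlen, hmem, hreg⟩ := ModuleCat.exists_isRegular_of_exists_subsingleton_ext
      (maximalIdeal R) (h + 1) (ModuleCat.of R R) hlt (ModuleCat.of R (R ⧸ maximalIdeal R)) hs
      fun i hi => hall i (Nat.lt_succ_iff.1 hi)
    have hd := ringKrullDim_add_length_eq_ringKrullDim_of_isRegular rs hreg
    have hnt : Nontrivial (R ⧸ Ideal.ofList rs) := by
      refine Ideal.Quotient.nontrivial_iff.2 fun htop => ?_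
      have : Ideal.ofList rs ≤ maximalIdeal R := Ideal.span_le.2 hmem
      exact (maximalIdeal.isMaximal R).ne_top (top_le_iff.1 (htop ▸ this))
    have h0 : (0 : WithBot ℕ∞) ≤ ringKrullDim (R ⧸ Ideal.ofList rs) :=
      ringKrullDim_nonneg_of_nontrivial
    have : ((h + 1 : ℕ) : WithBot ℕ∞) ≤ (h : ℕ) := by
      rw [← hdim, ← hd, hlen]
      exact le_add_of_nonneg_left h0
    have : h + 1 ≤ h := by exact_mod_cast this
    omega
  refine ⟨Nat.find hex, (Nat.find_spec hex).1, fun i hi => ?_, (Nat.find_spec hex).2⟩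
  by_contra hn
  exact Nat.find_min hex hi ⟨hi.le.trans (Nat.find_spec hex).1, hn⟩

theorem moduleDepth_eq_natCast {R N : Type} [CommRing R] [IsLocalRing R] [AddCommGroup N]
    [Module R N] {h : ℕ} (hN : moduleDepth R N = h) :
    (∀ i < h, ExtVanish R i (R ⧸ maximalIdeal R) N) ∧
      ¬ ExtVanish R h (R ⧸ maximalIdeal R) N := by
  constructor
  · intro i hi
    by_contra hn
    rw [← subsingleton_extGroup_iff, not_subsingleton_iff_nontrivial] at hn
    have : moduleDepth R N ≤ i := sInf_le ⟨i, rfl, hn⟩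
    rw [hN] at this
    exact absurd (Nat.cast_le.1 this) (not_le.2 hi)
  · have hne : {n : ℕ∞ | ∃ k : ℕ, n = k ∧
        Nontrivial (extGroup R k (R ⧸ maximalIdeal R) N)}.Nonempty := by
      by_contra! he
      rw [moduleDepth, he, sInf_empty] at hN
      exact ENat.top_ne_natCast h hN
    obtain ⟨k, hk, hnt⟩ := csInf_mem hne
    obtain rfl : h = k := by
      have : ((h : ℕ) : ℕ∞) = k := hN.symm.trans hk
      exact_mod_cast this
    rwa [← subsingleton_extGroup_iff, not_subsingleton_iff_nontrivial]

end

section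
variable {R A : Type} [CommRing R] [CommRing A] [Algebra R A] (S : Submonoid R)
  [IsLocalization S A]

theorem exists_extension_of_isLocalizedModule {K F N K' F' N' : Type}
    [AddCommGroup K] [Module R K] [AddCommGroup F] [Module R F] [AddCommGroup N] [Module R N]
    [AddCommGroup K'] [Module R K'] [Module A K'] [IsScalarTower R A K']
    [AddCommGroup F'] [Module R F'] [Module A F'] [IsScalarTower R A F']
    [AddCommGroup N'] [Module R N'] [Module A N'] [IsScalarTower R A N']
    [Module.FinitePresentation R K]
    (k : K →ₗ[R] K') [IsLocalizedModule S k] (f : F →ₗ[R] F') [IsLocalizedModule S f]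
    (g : N →ₗ[R] N') [IsLocalizedModule S g] (u : K →ₗ[R] F) (u' : K' →ₗ[A] F')
    (hu : ∀ x, u' (k x) = f (u x))
    (h : ∀ φ : K →ₗ[R] N, ∃ ψ : F →ₗ[R] N, ψ ∘ₗ u = φ) (φ : K' →ₗ[A] N') :
    ∃ ψ : F' →ₗ[A] N', ψ ∘ₗ u' = φ := by
  obtain ⟨φ₀, s, hφ₀⟩ := Module.FinitePresentation.exists_lift_of_isLocalizedModule S g
    (φ.restrictScalars R ∘ₗ k)
  obtain ⟨ψ₀, rfl⟩ := h φ₀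
  refine ⟨(IsLocalization.mk' A (1 : R) s) • IsLocalizedModule.mapExtendScalars S f g A ψ₀, ?_⟩
  have key : (((IsLocalization.mk' A (1 : R) s) •
      IsLocalizedModule.mapExtendScalars S f g A ψ₀) ∘ₗ u').restrictScalars R =
      φ.restrictScalars R := by
    refine IsLocalizedModule.ext S k (IsLocalizedModule.map_units g) (LinearMap.ext fun x => ?_)
    have hx := LinearMap.congr_fun hφ₀ x
    simp only [LinearMap.comp_apply, LinearMap.restrictScalars_apply, LinearMap.smul_apply, hu,
      IsLocalizedModule.mapExtendScalars_apply_apply, IsLocalizedModule.map_apply] at hx ⊢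
    rw [hx, Submonoid.smul_def, ← algebraMap_smul A (s : R), smul_smul, IsLocalization.mk'_spec,
      map_one, one_smul]
  exact LinearMap.ext fun x => LinearMap.congr_fun key x

theorem ExtVanish.of_isLocalizedModule [IsNoetherianRing R] {N N' : Type}
    [AddCommGroup N] [Module R N]
    [AddCommGroup N'] [Module R N'] [Module A N'] [IsScalarTower R A N']
    (g : N →ₗ[R] N') [IsLocalizedModule S g] {i : ℕ} {M M' : Type}
    [AddCommGroup M] [Module R M] [Module.Finite R M]
    [AddCommGroup M'] [Module R M'] [Module A M'] [IsScalarTower R A M']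
    (f : M →ₗ[R] M') [IsLocalizedModule S f]
    (h : ExtVanish R (i + 1) M N) : ExtVanish A (i + 1) M' N' := by
  induction i generalizing M M' with
  | zero =>
    obtain ⟨r, π, hπ⟩ := Module.Finite.exists_fin' R M
    let l : (Fin r → R) →ₗ[R] (Fin r → A) :=
      .pi fun i => Algebra.linearMap R A ∘ₗ .proj i
    have : IsLocalizedModule S l := inferInstance
    let π' : (Fin r → A) →ₗ[A] M' := IsLocalizedModule.mapExtendScalars S l f A π
    have hπ' : Function.Surjective π' := IsLocalizedModule.map_surjective S l f π hπ
    have hk : (LinearMap.ker π).localized' A S l = LinearMap.ker π' :=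
      LinearMap.localized'_ker_eq_ker_localizedMap A S l f π
    refine ExtVanish.one_of_exists_extension (A := ↥((LinearMap.ker π).localized' A S l))
      (f := ((LinearMap.ker π).localized' A S l).subtype) (g := π')
      (Submodule.injective_subtype _) ?_ hπ' fun φ => ?_
    · rw [LinearMap.exact_iff, Submodule.range_subtype, hk]
    · have := Module.finitePresentation_of_finite R (LinearMap.ker π)
      exact exists_extension_of_isLocalizedModule S
        ((LinearMap.ker π).toLocalized' A S l) l g (LinearMap.ker π).subtype _ (fun _ => rfl)
        (ExtVanish.exists_extension (Submodule.injective_subtype _)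
          (LinearMap.exact_subtype_ker_map π) hπ h) φ
  | succ i ih =>
    obtain ⟨r, π, hπ⟩ := Module.Finite.exists_fin' R M
    let l : (Fin r → R) →ₗ[R] (Fin r → A) :=
      .pi fun i => Algebra.linearMap R A ∘ₗ .proj i
    have : IsLocalizedModule S l := inferInstance
    let π' : (Fin r → A) →ₗ[A] M' := IsLocalizedModule.mapExtendScalars S l f A π
    have hπ' : Function.Surjective π' := IsLocalizedModule.map_surjective S l f π hπ
    have hk : (LinearMap.ker π).localized' A S l = LinearMap.ker π' :=
      LinearMap.localized'_ker_eq_ker_localizedMap A S l f π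
    refine (ExtVanish.shift_iff (A := ↥((LinearMap.ker π).localized' A S l))
      (f := ((LinearMap.ker π).localized' A S l).subtype) (g := π')
      (Submodule.injective_subtype _) ?_ hπ').2 ?_
    · rw [LinearMap.exact_iff, Submodule.range_subtype, hk]
    · exact ih ((LinearMap.ker π).toLocalized' A S l)
        ((ExtVanish.shift_iff (Submodule.injective_subtype _)
          (LinearMap.exact_subtype_ker_map π) hπ).1 h)

theorem exists_mem_factorIdeal_of_isLocalizedModule [IsNoetherianRing R] {F M F' M' : Type}
    [AddCommGroup F] [Module R F] [AddCommGroup M] [Module R M] [Module.Finite R M]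
    [AddCommGroup F'] [Module R F'] [Module A F'] [IsScalarTower R A F']
    [AddCommGroup M'] [Module R M'] [Module A M'] [IsScalarTower R A M']
    (l : F →ₗ[R] F') [IsLocalizedModule S l] (f : M →ₗ[R] M') [IsLocalizedModule S f]
    {π : F →ₗ[R] M} (σ : M' →ₗ[A] F')
    (hσ : IsLocalizedModule.mapExtendScalars S l f A π ∘ₗ σ = LinearMap.id) :
    ∃ s ∈ S, s ∈ factorIdeal π := by
  have := Module.finitePresentation_of_finite R M
  obtain ⟨τ, s, hτ⟩ := Module.FinitePresentation.exists_lift_of_isLocalizedModule S l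
    (σ.restrictScalars R ∘ₗ f)
  have hf : f ∘ₗ (π ∘ₗ τ) = f ∘ₗ ((s : R) • LinearMap.id) := by
    ext x
    have h1 := LinearMap.congr_fun hτ x
    have h2 := LinearMap.congr_fun hσ (f x)
    simp only [LinearMap.comp_apply, LinearMap.restrictScalars_apply, LinearMap.smul_apply,
      LinearMap.id_apply, map_smul] at h1 h2 ⊢
    rw [← IsLocalizedModule.map_apply S l f π, h1, Submonoid.smul_def, map_smul]
    exact congrArg _ h2
  obtain ⟨t, ht⟩ := Module.Finite.exists_smul_of_comp_eq_of_isLocalizedModule S f _ _ hf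
  refine ⟨t * s, mul_mem t.2 s.2, (t : R) • τ, ?_⟩
  rw [LinearMap.comp_smul, mul_smul]
  exact ht

theorem map_factorIdeal_le_of_isLocalizedModule {F M F' M' : Type}
    [AddCommGroup F] [Module R F] [AddCommGroup M] [Module R M]
    [AddCommGroup F'] [Module R F'] [Module A F'] [IsScalarTower R A F']
    [AddCommGroup M'] [Module R M'] [Module A M'] [IsScalarTower R A M']
    (l : F →ₗ[R] F') [IsLocalizedModule S l] (f : M →ₗ[R] M') [IsLocalizedModule S f]
    (π : F →ₗ[R] M) :
    (factorIdeal π).map (algebraMap R A) ≤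
      factorIdeal (IsLocalizedModule.mapExtendScalars S l f A π) := by
  rw [Ideal.map_le_iff_le_comap]
  rintro a ⟨s, hs⟩
  refine ⟨IsLocalizedModule.mapExtendScalars S f l A s, ?_⟩
  have key : (IsLocalizedModule.mapExtendScalars S l f A π ∘ₗ
      IsLocalizedModule.mapExtendScalars S f l A s).restrictScalars R =
      a • LinearMap.id := by
    refine IsLocalizedModule.ext S f (IsLocalizedModule.map_units f) (LinearMap.ext fun x => ?_)
    have := LinearMap.congr_fun hs x
    simp only [LinearMap.comp_apply, LinearMap.smul_apply, LinearMap.id_apply,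
      LinearMap.restrictScalars_apply,
      IsLocalizedModule.mapExtendScalars_apply_apply, IsLocalizedModule.map_apply] at this ⊢
    rw [this, map_smul]
  refine LinearMap.ext fun x => (LinearMap.congr_fun key x).trans ?_
  simp [algebraMap_smul]

end

section
variable {R : Type} [CommRing R]

theorem exists_natCast_eq_ringKrullDim_localization [IsLocalRing R] {d : ℕ}
    (hd : ringKrullDim R = d) (p : Ideal R) [p.IsPrime] :
    ∃ h ≤ d, ringKrullDim (Localization.AtPrime p) = (h : ℕ) := by
  rw [IsLocalization.AtPrime.ringKrullDim_eq_height p]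
  have h1 : ((p.height : ℕ∞) : WithBot ℕ∞) ≤ ((d : ℕ∞) : WithBot ℕ∞) :=
    Ideal.height_le_ringKrullDim_of_isPrime.trans_eq hd
  have h1 := WithBot.coe_le_coe.1 h1
  obtain ⟨h, hh⟩ := ENat.ne_top_iff_exists.1 (ne_top_of_le_ne_top (ENat.natCast_ne_top d) h1)
  rw [← hh] at h1 ⊢
  exact ⟨h, by exact_mod_cast h1, rfl⟩

theorem factorIdeal_eq_top [IsNoetherianRing R]
    [IsLocalRing R] {d n : ℕ} (hd : ringKrullDim R = d)
    (hn1 : 1 ≤ n)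
    {M N : Type} [AddCommGroup M] [Module R M] [Module.Finite R M]
    [AddCommGroup N] [Module R N] [Module.Finite R N]
    (hMp : ∀ p : PrimeSpectrum R, ringKrullDim (Localization.AtPrime p.asIdeal) ≤ (n : WithBot ℕ∞) →
      ∃ k : ℕ, hasPdLE (Localization.AtPrime p.asIdeal) k (LocalizedModule p.asIdeal.primeCompl M))
    (hN : IsMCM R N)
    (hsupp : ∀ p : PrimeSpectrum R, Nontrivial (LocalizedModule p.asIdeal.primeCompl N))
    (h1 : ∀ i : ℕ, 1 ≤ i → i ≤ d → ExtVanish R i M N)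
    (h2 : ∀ j : ℕ, n ≤ j → j ≤ d - 1 → ExtVanish R j (M →ₗ[R] R) (M →ₗ[R] N))
    {r : ℕ} {π : (Fin r → R) →ₗ[R] M} (hπ : Function.Surjective π) :
    factorIdeal π = ⊤ := by
  by_contra hne
  obtain ⟨p, hp⟩ := Ideal.nonempty_minimalPrimes hne
  have hprime : p.IsPrime := hp.1.1
  have := Module.finitePresentation_of_finite R M
  let P : PrimeSpectrum R := ⟨p, hprime⟩
  let S := p.primeCompl
  let A := Localization.AtPrime p
  let M' := LocalizedModule S M
  let N' := LocalizedModule S N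
  let f : M →ₗ[R] M' := LocalizedModule.mkLinearMap S M
  let g : N →ₗ[R] N' := LocalizedModule.mkLinearMap S N
  let l : (Fin r → R) →ₗ[R] (Fin r → A) := .pi fun i => Algebra.linearMap R A ∘ₗ .proj i
  have : IsLocalizedModule S l := inferInstance
  have : IsNoetherianRing A := IsLocalization.isNoetherianRing S A inferInstance
  have : Nontrivial N' := hsupp P
  have : Module.Finite A M' := inferInstance
  have : Module.Finite A N' := inferInstance
  let π' : (Fin r → A) →ₗ[A] M' := IsLocalizedModule.mapExtendScalars S l f A π
  have hπ' : Function.Surjective π' := IsLocalizedModule.map_surjective S l f π hπ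
  obtain ⟨h, hhd, hh⟩ := exists_natCast_eq_ringKrullDim_localization hd p
  have hdep : moduleDepth A N' = h := by
    have h0 : (moduleDepth A N' : WithBot ℕ∞) = ((h : ℕ∞) : WithBot ℕ∞) := (hN P ‹_›).trans hh
    exact WithBot.coe_injective h0
  obtain ⟨hk, hk'⟩ := moduleDepth_eq_natCast hdep
  have hM : ∀ i, 1 ≤ i → i ≤ h → ExtVanish A i M' N' := by
    intro i hi hih
    obtain ⟨i, rfl⟩ := Nat.exists_eq_succ_of_ne_zero (Nat.one_le_iff_ne_zero.1 hi)
    exact ExtVanish.of_isLocalizedModule S g f (h1 _ hi (hih.trans hhd))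
  have hfree : Module.Free A M' := by
    rcases le_or_gt h n with hle | hlt
    · have hle' : ringKrullDim A ≤ (n : WithBot ℕ∞) := by
        rw [hh]
        exact_mod_cast hle
      obtain ⟨k, hpd⟩ := hMp P hle'
      obtain ⟨t, hth, ht, ht'⟩ := exists_least_not_extVanish_self hh
      exact free_of_extDimLE_of_extVanish hth ht ht' k (.of_hasPdLE hpd) hM
    · obtain ⟨h, rfl⟩ := Nat.exists_eq_add_of_le' (show 2 ≤ h by omega)
      refine free_of_extVanish_dual hπ' ?_ hk hk' hM ?_
      · rw [← IsLocalization.AtPrime.map_eq_maximalIdeal p A,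
          ← IsLocalization.AtPrime.radical_map_of_mem_minimalPrimes (A := A) p _ hp]
        exact Ideal.radical_mono (map_factorIdeal_le_of_isLocalizedModule S l f π)
      · exact ExtVanish.of_isLocalizedModule S
          (IsLocalizedModule.mapExtendScalars S f g A)
          (IsLocalizedModule.mapExtendScalars S f (Algebra.linearMap R A) A)
          (h2 (h + 1) (by omega) (by omega))
  obtain ⟨σ, hσ⟩ := Module.projective_lifting_property π' LinearMap.id hπ'
  obtain ⟨s, hs, hsI⟩ := exists_mem_factorIdeal_of_isLocalizedModule S l f σ hσ
  exact hs (hp.1.2 hsI)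

end

/-- Freeness criterion: vanishing of `Ext^i(M, N)` and `Ext^j(M^*, Hom(M,N))` forces `M`
to be free, for `N` MCM with full support and `M` locally of finite projective dimension in
codimension `n`. -/
theorem free_of_ext_vanishing_with_mcm_full_support (R : Type) [CommRing R] [IsNoetherianRing R]
    [IsLocalRing R] (d n : ℕ) (hd : ringKrullDim R = d) (hd2 : 2 ≤ d)
    (hn1 : 1 ≤ n) (hn2 : n ≤ d - 1) (hCM : IsCMLocal R)
    (M N : Type) [AddCommGroup M] [Module R M] [Module.Finite R M]
    [AddCommGroup N] [Module R N] [Module.Finite R N]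
    (hMp : ∀ p : PrimeSpectrum R, ringKrullDim (Localization.AtPrime p.asIdeal) ≤ (n : WithBot ℕ∞) →
      ∃ k : ℕ, hasPdLE (Localization.AtPrime p.asIdeal) k (LocalizedModule p.asIdeal.primeCompl M))
    (hN : IsMCM R N)
    (hsupp : ∀ p : PrimeSpectrum R, Nontrivial (LocalizedModule p.asIdeal.primeCompl N))
    (h1 : ∀ i : ℕ, 1 ≤ i → i ≤ d → Subsingleton (extGroup R i M N))
    (h2 : ∀ j : ℕ, n ≤ j → j ≤ d - 1 → Subsingleton (extGroup R j (M →ₗ[R] R) (M →ₗ[R] N))) :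
    Module.Free R M := by
  obtain ⟨r, π, hπ⟩ := Module.Finite.exists_fin' R M
  refine free_of_one_mem_factorIdeal (π := π) ?_
  rw [← Ideal.eq_top_iff_one]
  exact factorIdeal_eq_top hd hn1 hMp hN hsupp
    (fun i hi hi' => subsingleton_extGroup_iff.1 (h1 i hi hi'))
    (fun j hj hj' => subsingleton_extGroup_iff.1 (h2 j hj hj')) hπ
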